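/- Density of points in finite-energy jellium configurations: Let d ≥ 2, m > 0 and 0 < η ≤ 1. Let Λ ⊂ ℝ^d be such that Λ ∩ K is finite for every compact set K, let N : Λ → {1,2,3,…}, and let h ∈ C¹(ℝ^d) satisfy, for every φ ∈ C_c^∞(ℝ^d): ∫ ∇h·∇φ = c_d ( Σ_{p∈Λ} N_p ∫ ρ_η(x−p) φ(x) dx − m ∫ φ ). If limsup_{R→∞} (2R)^{−d} ∫_{K_R} |∇h|² < ∞, where K_R = [−R,R]^d, then lim_{R→∞} (2R)^{−d} Σ_{p∈Λ∩K_R} N_p = m. -/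

import Mathlib

open MeasureTheory Metric Real Filter
open scoped Topology ENNReal BigOperators RealInnerProductSpace

noncomputable section

/-- Euclidean space `ℝ^d`. -/
abbrev Euc (d : ℕ) := EuclideanSpace ℝ (Fin d)

/-- The constant `c_d`: `2π` for `d = 2` and `(d−2)|S^{d−1}|` for `d ≥ 3`
(using `|S^{d-1}| = d · |B(0,1)|`). -/
def cConst (d : ℕ) : ℝ :=
  if d = 2 then 2 * π
  else ((d : ℝ) - 2) * d * (volume (ball (0 : Euc d) 1)).toReal

/-- The smeared Dirac mass `δ_p^{(η)}`: density `ρ_η(x - p)` with `ρ_η(x) = η^{-d} ρ(x/η)`. -/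
def smear (d : ℕ) (ρ : Euc d → ℝ) (η : ℝ) (p : Euc d) (x : Euc d) : ℝ :=
  (η ^ d)⁻¹ * ρ (η⁻¹ • (x - p))

/-- The hypercube `K_s = [−s, s]^d`. -/
def Kcube (d : ℕ) (s : ℝ) : Set (Euc d) := {z : Euc d | ∀ i, z i ∈ Set.Icc (-s) s}

theorem Kcube_mem_iff {d : ℕ} {s : ℝ} {z : Euc d} : z ∈ Kcube d s ↔ ∀ i, |z i| ≤ s := by
  simp only [Kcube, Set.mem_ofPred_eq, Set.mem_Icc, abs_le]

theorem Kcube_mono {d : ℕ} {s t : ℝ} (hst : s ≤ t) : Kcube d s ⊆ Kcube d t := fun _ hz =>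
  Kcube_mem_iff.2 fun i => (Kcube_mem_iff.1 hz i).trans hst

theorem Kcube_eq_preimage (d : ℕ) (s : ℝ) :
    Kcube d s = (WithLp.ofLp : Euc d → Fin d → ℝ) ⁻¹'
      Set.Icc (fun _ => -s) (fun _ => s) := by
  ext z
  simp [Kcube, Pi.le_def, forall_and]

theorem isCompact_Kcube (d : ℕ) (s : ℝ) : IsCompact (Kcube d s) := by
  rw [Kcube_eq_preimage]
  exact (PiLp.homeomorph 2 (fun _ : Fin d => ℝ)).isCompact_preimage.2 isCompact_Icc

theorem measureReal_Kcube (d : ℕ) {s : ℝ} (hs : 0 ≤ s) :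
    volume.real (Kcube d s) = (2 * s) ^ d := by
  rw [Measure.real, Kcube_eq_preimage,
    (PiLp.volume_preserving_ofLp (Fin d)).measure_preimage measurableSet_Icc.nullMeasurableSet,
    Real.volume_Icc_pi_toReal (fun _ => by linarith)]
  simp [two_mul]

theorem smul_mem_Kcube_iff {d : ℕ} {R s : ℝ} (hR : 0 < R) {z : Euc d} :
    R⁻¹ • z ∈ Kcube d s ↔ z ∈ Kcube d (s * R) := by
  simp only [Kcube_mem_iff, PiLp.smul_apply, smul_eq_mul, abs_mul, abs_inv, abs_of_pos hR]
  refine forall_congr' fun i => ?_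
  rw [inv_mul_le_iff₀ hR, mul_comm]

theorem mem_Kcube_of_norm_sub_le {d : ℕ} {s r : ℝ} {x y : Euc d} (hx : x ∈ Kcube d s)
    (hxy : ‖x - y‖ ≤ r) : y ∈ Kcube d (s + r) := by
  refine Kcube_mem_iff.2 fun i => ?_
  have h1 := Kcube_mem_iff.1 hx i
  have h2 : |x i - y i| ≤ r := (PiLp.norm_apply_le (x - y) i).trans hxy
  have h3 := abs_sub_abs_le_abs_sub (y i) (x i)
  rw [abs_sub_comm] at h3
  linarith

/-- A smooth cutoff function equal to `1` on `Kcube d a` and vanishing off `Kcube d b`. -/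
theorem exists_cutoff_Kcube (d : ℕ) {a b : ℝ} (hab : a < b) :
    ∃ ψ : Euc d → ℝ, ContDiff ℝ (⊤ : ℕ∞) ψ ∧ (∀ x, ψ x ∈ Set.Icc (0 : ℝ) 1) ∧
      (∀ x ∈ Kcube d a, ψ x = 1) ∧ ∀ x ∉ Kcube d b, ψ x = 0 := by
  have hc : IsClosed {z : Euc d | ∃ i, b ≤ |z i|} := by
    simp only [Set.ofPred_exists]
    exact isClosed_iUnion_of_finite fun i => isClosed_le (by fun_prop) (by fun_prop)
  obtain ⟨f, hf, hr, h0, h1⟩ := exists_contMDiff_zero_iff_one_iff_of_isClosed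
    (modelWithCornersSelf ℝ (Euc d)) (n := (⊤ : ℕ∞)) hc (isCompact_Kcube d a).isClosed (by
      rw [Set.disjoint_left]
      rintro z ⟨i, hi⟩ hz
      linarith [Kcube_mem_iff.1 hz i])
  refine ⟨f, hf.contDiff, fun x => hr ⟨x, rfl⟩, fun x hx => (h1 x).1 hx, fun x hx => (h0 x).1 ?_⟩
  rw [Kcube_mem_iff] at hx
  push Not at hx
  exact hx.imp fun i hi => hi.le

theorem cConst_pos {d : ℕ} (hd : 2 ≤ d) : 0 < cConst d := by
  unfold cConst
  split_ifs with h
  · positivity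
  · have h3 : (2 : ℝ) < d := by exact_mod_cast lt_of_le_of_ne hd (Ne.symm h)
    have hv : 0 < (volume (ball (0 : Euc d) 1)).toReal :=
      ENNReal.toReal_pos (measure_ball_pos _ _ one_pos).ne' measure_ball_lt_top.ne
    have : 0 < (d : ℝ) - 2 := by linarith
    positivity

section Smear

variable {d : ℕ} {ρ : Euc d → ℝ} {η : ℝ}

theorem smear_nonneg (hρ : ∀ x, 0 ≤ ρ x) (hη : 0 < η) (p x : Euc d) : 0 ≤ smear d ρ η p x :=
  mul_nonneg (by positivity) (hρ _)

theorem smear_eq_zero (hsupp : Function.support ρ ⊆ closedBall 0 1) (hη : 0 < η) {p x : Euc d}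
    (hx : η < ‖x - p‖) : smear d ρ η p x = 0 := by
  have : ρ (η⁻¹ • (x - p)) = 0 := by
    by_contra hne
    have := hsupp hne
    rw [mem_closedBall_zero_iff, norm_smul, norm_inv, Real.norm_of_nonneg hη.le,
      inv_mul_le_iff₀ hη] at this
    linarith
  simp [smear, this]

theorem integrable_smear (hint : Integrable ρ) (hη : 0 < η) (p : Euc d) :
    Integrable (smear d ρ η p) :=
  ((hint.comp_smul (inv_ne_zero hη.ne')).comp_sub_right p).const_mul _

theorem integral_smear (hη : 0 < η) (p : Euc d) : ∫ x, smear d ρ η p x = ∫ x, ρ x := by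
  simp only [smear]
  rw [integral_const_mul, integral_sub_right_eq_self (fun x => ρ (η⁻¹ • x)) p,
    Measure.integral_comp_inv_smul_of_nonneg _ _ hη.le]
  simp only [finrank_euclideanSpace, Fintype.card_fin, smul_eq_mul]
  rw [inv_mul_cancel_left₀ (by positivity)]

theorem integral_smear_mul_nonneg (hρ : ∀ x, 0 ≤ ρ x) (hη : 0 < η) {φ : Euc d → ℝ}
    (hφ : ∀ x, 0 ≤ φ x) (p : Euc d) : 0 ≤ ∫ x, smear d ρ η p x * φ x :=
  integral_nonneg fun x => mul_nonneg (smear_nonneg hρ hη p x) (hφ x)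

theorem integral_smear_mul_le (hρ : ∀ x, 0 ≤ ρ x) (hint : Integrable ρ) (hη : 0 < η)
    {φ : Euc d → ℝ} (hφ : ∀ x, φ x ∈ Set.Icc (0 : ℝ) 1) (p : Euc d) :
    ∫ x, smear d ρ η p x * φ x ≤ ∫ x, ρ x := by
  rw [← integral_smear (ρ := ρ) hη p]
  refine integral_mono_of_nonneg
    (.of_forall fun x => mul_nonneg (smear_nonneg hρ hη p x) (hφ x).1)
    (integrable_smear hint hη p) (.of_forall fun x => ?_)
  exact mul_le_of_le_one_right (smear_nonneg hρ hη p x) (hφ x).2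

theorem integral_smear_mul_eq_of_one (hsupp : Function.support ρ ⊆ closedBall 0 1) (hη : 0 < η)
    {φ : Euc d → ℝ} {p : Euc d} (hφ : ∀ x, ‖x - p‖ ≤ η → φ x = 1) :
    ∫ x, smear d ρ η p x * φ x = ∫ x, ρ x := by
  rw [← integral_smear (ρ := ρ) hη p]
  refine integral_congr_ae (.of_forall fun x => ?_)
  rcases le_or_gt ‖x - p‖ η with hx | hx
  · simp [hφ x hx]
  · simp [smear_eq_zero hsupp hη hx]

theorem integral_smear_mul_eq_zero (hsupp : Function.support ρ ⊆ closedBall 0 1) (hη : 0 < η)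
    {φ : Euc d → ℝ} {p : Euc d} (hφ : ∀ x, ‖x - p‖ ≤ η → φ x = 0) :
    ∫ x, smear d ρ η p x * φ x = 0 := by
  rw [← integral_zero (Euc d) ℝ (μ := volume)]
  refine integral_congr_ae (.of_forall fun x => ?_)
  rcases le_or_gt ‖x - p‖ η with hx | hx
  · simp [hφ x hx]
  · simp [smear_eq_zero hsupp hη hx]

end Smear

theorem summable_of_eq_zero_off_Kcube {d : ℕ} {Λ : Set (Euc d)}
    (hΛ : ∀ K : Set (Euc d), IsCompact K → (Λ ∩ K).Finite) {f : Euc d → ℝ} {s : ℝ}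
    (hf : ∀ p ∉ Kcube d s, f p = 0) : Summable fun p : Λ => f p := by
  refine summable_of_hasFiniteSupport ?_
  refine Set.Finite.of_finite_image (f := Subtype.val) ?_ Subtype.val_injective.injOn
  refine (hΛ _ (isCompact_Kcube d s)).subset ?_
  rintro _ ⟨p, hp, rfl⟩
  exact ⟨p.2, by_contra fun h => hp (hf _ h)⟩

theorem gradient_comp_smul {d : ℕ} (ψ : Euc d → ℝ) (c : ℝ) (x : Euc d) :
    gradient (fun y => ψ (c • y)) x = c • gradient ψ (c • x) := by
  simp only [gradient, fderiv_comp_smul, map_smul]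

theorem gradient_eq_zero_off_Kcube {d : ℕ} {ψ : Euc d → ℝ} {b : ℝ}
    (hψ : ∀ x ∉ Kcube d b, ψ x = 0) {x : Euc d} (hx : x ∉ Kcube d b) : gradient ψ x = 0 := by
  have : ψ =ᶠ[𝓝 x] fun _ => 0 := by
    filter_upwards [(isCompact_Kcube d b).isClosed.isOpen_compl.mem_nhds hx] with y hy
    exact hψ y hy
  simp [gradient, this.fderiv_eq]

theorem continuous_gradient {d : ℕ} {h : Euc d → ℝ} (hh : ContDiff ℝ 1 h) :
    Continuous (gradient h) :=
  (InnerProductSpace.toDual ℝ (Euc d)).symm.continuous.comp (hh.continuous_fderiv one_ne_zero)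

/-- If `∇h` has bounded energy density on large cubes, then its flux against the gradient of a
rescaled fixed cutoff is of smaller order than the volume. -/
theorem tendsto_integral_inner_gradient_rescale {d : ℕ} {h ψ : Euc d → ℝ} (hh : ContDiff ℝ 1 h)
    (hψ : ContDiff ℝ 1 ψ) {b : ℝ} (hb : 0 < b) (hψb : ∀ x ∉ Kcube d b, ψ x = 0) {C : ℝ}
    (hE : ∀ R : ℝ, 1 ≤ R → (∫ x in Kcube d R, ‖gradient h x‖ ^ 2) ≤ C * (2 * R) ^ d) :
    Tendsto (fun R : ℝ => (∫ x, ⟪gradient h x, gradient (fun y => ψ (R⁻¹ • y)) x⟫) / (2 * R) ^ d)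
      atTop (𝓝 0) := by
  obtain ⟨G, hG⟩ : ∃ G, ∀ x ∈ Kcube d b, ‖gradient ψ x‖ ≤ G :=
    (isCompact_Kcube d b).exists_bound_of_continuousOn (continuous_gradient hψ).continuousOn
  have hG0 : 0 ≤ G := (norm_nonneg _).trans (hG 0 (Kcube_mem_iff.2 fun i => by simpa using hb.le))
  have hGall : ∀ x, ‖gradient ψ x‖ ≤ G := fun x => by
    by_cases hx : x ∈ Kcube d b
    · exact hG x hx
    · simpa [gradient_eq_zero_off_Kcube hψb hx] using hG0
  have hlim : Tendsto (fun R : ℝ => R⁻¹ * (G * ((C + 1) * b ^ d))) atTop (𝓝 0) := by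
    simpa using tendsto_inv_atTop_zero.mul_const (G * ((C + 1) * b ^ d))
  refine squeeze_zero_norm' ?_ hlim
  filter_upwards [eventually_ge_atTop 1, eventually_ge_atTop b⁻¹] with R hR1 hRb
  have hR : 0 < R := by linarith
  have hbR : 1 ≤ b * R := by
    rw [inv_le_iff_one_le_mul₀ hb] at hRb
    linarith
  have hV : volume (Kcube d (b * R)) ≠ ⊤ := (isCompact_Kcube d _).measure_ne_top
  have hgi : IntegrableOn (fun x => ‖gradient h x‖ ^ 2 + 1) (Kcube d (b * R)) :=
    (((continuous_gradient hh).norm.pow 2).add continuous_const).continuousOn.integrableOn_compact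
      (isCompact_Kcube d _)
  have hg2 : IntegrableOn (fun x => ‖gradient h x‖ ^ 2) (Kcube d (b * R)) :=
    ((continuous_gradient hh).norm.pow 2).continuousOn.integrableOn_compact (isCompact_Kcube d _)
  have key : ‖∫ x, ⟪gradient h x, gradient (fun y => ψ (R⁻¹ • y)) x⟫‖ ≤
      R⁻¹ * G * ∫ x in Kcube d (b * R), (‖gradient h x‖ ^ 2 + 1) := by
    rw [← setIntegral_eq_integral_of_forall_compl_eq_zero (s := Kcube d (b * R)) (fun x hx => by
      rw [gradient_comp_smul, gradient_eq_zero_off_Kcube hψb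
        (fun hx' => hx ((smul_mem_Kcube_iff hR).1 hx'))]
      simp), ← integral_const_mul]
    refine norm_integral_le_of_norm_le (hgi.const_mul _) (.of_forall fun x => ?_)
    refine (norm_inner_le_norm _ _).trans ?_
    rw [gradient_comp_smul, norm_smul, norm_inv, Real.norm_of_nonneg hR.le, mul_comm]
    have h1 := hGall (R⁻¹ • x)
    gcongr
    nlinarith [sq_nonneg (‖gradient h x‖ - 1), norm_nonneg (gradient h x)]
  have hint : ∫ x in Kcube d (b * R), (‖gradient h x‖ ^ 2 + 1) ≤
      (C + 1) * (2 * (b * R)) ^ d := by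
    rw [integral_add hg2 (integrableOn_const hV), setIntegral_const,
      measureReal_Kcube d (by linarith)]
    simp only [smul_eq_mul, mul_one]
    linarith [hE _ hbR]
  rw [norm_div, Real.norm_of_nonneg (by positivity : 0 ≤ (2 * R) ^ d), div_le_iff₀ (by positivity)]
  calc _ ≤ _ := key
    _ ≤ R⁻¹ * G * ((C + 1) * (2 * (b * R)) ^ d) := by gcongr
    _ = _ := by rw [show 2 * (b * R) = b * (2 * R) by ring, mul_pow]; ring

/-- **Density of points in finite-energy jellium configurations.** Let `Λ` be locally finite,
`N : Λ → ℕ^*`, and `h ∈ C¹(ℝ^d)` solve `−Δh = c_d(Σ_{p∈Λ} N_p δ_p^{(η)} − m)` weakly in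
`ℝ^d`. If `limsup_{R→∞} (2R)^{−d} ∫_{K_R} |∇h|² < ∞` then
`(2R)^{−d} Σ_{p∈Λ∩K_R} N_p → m` as `R → ∞`. -/
theorem density_of_points
    (d : ℕ) (hd : 2 ≤ d)
    -- the fixed radial smearing function ρ
    (ρ : Euc d → ℝ) (hρmeas : Measurable ρ) (hρnonneg : ∀ x, 0 ≤ ρ x)
    (hρradial : ∀ x y : Euc d, ‖x‖ = ‖y‖ → ρ x = ρ y)
    (hρsupp : Function.support ρ ⊆ closedBall 0 1)
    (hρint : ∫ x, ρ x = 1)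
    (m : ℝ) (hm : 0 < m) (η : ℝ) (hη0 : 0 < η) (hη1 : η ≤ 1)
    (Λ : Set (Euc d)) (hΛfin : ∀ K : Set (Euc d), IsCompact K → (Λ ∩ K).Finite)
    (N : Euc d → ℕ) (hN : ∀ p ∈ Λ, 1 ≤ N p)
    (h : Euc d → ℝ) (hreg : ContDiff ℝ 1 h)
    -- the weak equation −Δh = c_d (Σ_{p∈Λ} N_p δ_p^{(η)} − m) in ℝ^d
    (heq : ∀ φ : Euc d → ℝ, ContDiff ℝ (⊤ : ℕ∞) φ → HasCompactSupport φ →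
      ∫ x, ⟪gradient h x, gradient φ x⟫ =
        cConst d * ((∑' p : Λ, (N p : ℝ) * ∫ x, smear d ρ η p x * φ x) - m * ∫ x, φ x))
    -- finite asymptotic energy density: limsup_{R→∞} (2R)^{-d} ∫_{K_R} |∇h|² < ∞
    (hE : ∃ CE : ℝ, ∀ R : ℝ, 1 ≤ R →
      (∫ x in Kcube d R, ‖gradient h x‖ ^ 2) ≤ CE * (2 * R) ^ d) :
    Tendsto (fun R : ℝ =>
        (∑' p : Λ, (Kcube d R).indicator (fun _ => (N p : ℝ)) p) / (2 * R) ^ d)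
      atTop (𝓝 m) := by
  obtain ⟨C, hC⟩ := hE
  have hρi : Integrable ρ := by
    by_contra hni
    rw [integral_undef hni] at hρint
    exact zero_ne_one hρint
  have hcpos := cConst_pos hd
  have hlimit : ∀ (ψ : Euc d → ℝ) (b : ℝ), 0 < b → ContDiff ℝ (⊤ : ℕ∞) ψ →
      (∀ x ∉ Kcube d b, ψ x = 0) →
      Tendsto (fun R : ℝ => (∑' p : Λ, (N p : ℝ) * ∫ x, smear d ρ η p x * ψ (R⁻¹ • x)) /
        (2 * R) ^ d) atTop (𝓝 (m * ((∫ x, ψ x) / 2 ^ d))) := by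
    intro ψ b hb hψ hψb
    have h1 := ((tendsto_integral_inner_gradient_rescale hreg
      (hψ.of_le (by exact_mod_cast le_top)) hb hψb hC).const_mul
      (cConst d)⁻¹).add_const (m * ((∫ x, ψ x) / 2 ^ d))
    rw [mul_zero, zero_add] at h1
    refine h1.congr' ?_
    filter_upwards [eventually_gt_atTop 0] with R hR
    rw [heq (fun y => ψ (R⁻¹ • y)) (hψ.comp (contDiff_const_smul _))
      (HasCompactSupport.intro (isCompact_Kcube d (b * R)) fun x hx =>
        hψb _ fun hx' => hx ((smul_mem_Kcube_iff hR).1 hx')),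
      Measure.integral_comp_inv_smul_of_nonneg _ _ hR.le]
    simp only [finrank_euclideanSpace, Fintype.card_fin, smul_eq_mul]
    field_simp
    ring
  have hsummable : ∀ (R b : ℝ), 0 < R → ∀ ψ : Euc d → ℝ, (∀ x ∉ Kcube d b, ψ x = 0) →
      Summable fun p : Λ => (N p : ℝ) * ∫ x, smear d ρ η p x * ψ (R⁻¹ • x) := by
    intro R b hR ψ hψb
    refine summable_of_eq_zero_off_Kcube (s := b * R + η) hΛfin
      (f := fun p => (N p : ℝ) * ∫ x, smear d ρ η p x * ψ (R⁻¹ • x)) fun p hp => ?_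
    rw [integral_smear_mul_eq_zero hρsupp hη0 (fun x hx => hψb _ fun hx' =>
      hp (mem_Kcube_of_norm_sub_le ((smul_mem_Kcube_iff hR).1 hx') hx)), mul_zero]
  have hsummable' : ∀ R : ℝ,
      Summable fun p : Λ => (Kcube d R).indicator (fun _ => (N p : ℝ)) (p : Euc d) := fun R =>
    summable_of_eq_zero_off_Kcube (s := R) hΛfin
      (f := fun p => (Kcube d R).indicator (fun _ => (N p : ℝ)) p)
      fun p hp => Set.indicator_of_notMem hp _
  have hcutint : ∀ (ψ : Euc d → ℝ) (a b : ℝ), 0 ≤ a → a < b → ContDiff ℝ (⊤ : ℕ∞) ψ →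
      (∀ x, ψ x ∈ Set.Icc (0 : ℝ) 1) → (∀ x ∈ Kcube d a, ψ x = 1) →
      (∀ x ∉ Kcube d b, ψ x = 0) → a ^ d ≤ (∫ x, ψ x) / 2 ^ d ∧ (∫ x, ψ x) / 2 ^ d ≤ b ^ d := by
    intro ψ a b ha hab hψ h01 h1 h0
    have hi : Integrable ψ := hψ.continuous.integrable_of_hasCompactSupport
      (HasCompactSupport.intro (isCompact_Kcube d b) h0)
    have hind : ∀ s, 0 ≤ s → Integrable ((Kcube d s).indicator fun _ => (1 : ℝ)) ∧
        ∫ x, (Kcube d s).indicator (fun _ => (1 : ℝ)) x = (2 * s) ^ d := fun s hs => by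
      have hms := (isCompact_Kcube d s).isClosed.measurableSet
      refine ⟨(integrable_indicator_iff hms).2
        (integrableOn_const (isCompact_Kcube d s).measure_ne_top), ?_⟩
      rw [integral_indicator hms, setIntegral_const, measureReal_Kcube d hs, smul_eq_mul, mul_one]
    rw [le_div_iff₀ (by positivity), div_le_iff₀ (by positivity), ← mul_pow, ← mul_pow,
      mul_comm a, mul_comm b, ← (hind a ha).2, ← (hind b (by linarith)).2]
    constructor
    · refine integral_mono (hind a ha).1 hi fun x => ?_
      by_cases hx : x ∈ Kcube d a
      · simp [hx, h1 x hx]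
      · simpa [hx] using (h01 x).1
    · refine integral_mono hi (hind b (by linarith)).1 fun x => ?_
      by_cases hx : x ∈ Kcube d b
      · simpa [hx] using (h01 x).2
      · simp [hx, h0 x hx]
  have hcont : ∀ s : ℝ, Tendsto (fun ε : ℝ => m * (1 + s * ε) ^ d) (𝓝[>] 0) (𝓝 m) := fun s => by
    have : Continuous fun ε : ℝ => m * (1 + s * ε) ^ d := by fun_prop
    simpa using (this.tendsto 0).mono_left nhdsWithin_le_nhds
  refine tendsto_order.2 ⟨fun l hl => ?_, fun u hu => ?_⟩
  · obtain ⟨ε, hεl, hε0, hε⟩ := (((hcont (-2)).eventually (lt_mem_nhds hl)).and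
      (Ioo_mem_nhdsGT (show (0 : ℝ) < 1 / 2 by norm_num))).exists
    obtain ⟨ψ, hψ, h01, h1, h0⟩ := exists_cutoff_Kcube d (show 1 - 2 * ε < 1 - ε by linarith)
    have hI := (hcutint ψ _ _ (by linarith) (by linarith) hψ h01 h1 h0).1
    have hlt : l < m * ((∫ x, ψ x) / 2 ^ d) := by
      refine hεl.trans_le ?_
      rw [show 1 + -2 * ε = 1 - 2 * ε by ring]
      gcongr
    filter_upwards [(hlimit ψ _ (by linarith) hψ h0).eventually (lt_mem_nhds hlt),
      eventually_gt_atTop 0, eventually_ge_atTop ε⁻¹] with R hR hR0 hRε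
    refine hR.trans_le ?_
    rw [inv_le_iff_one_le_mul₀ hε0] at hRε
    gcongr ?_ / _
    refine (hsummable R _ hR0 ψ h0).tsum_le_tsum (fun p => ?_) (hsummable' R)
    by_cases hp : (p : Euc d) ∈ Kcube d R
    · rw [Set.indicator_of_mem hp]
      refine mul_le_of_le_one_right (Nat.cast_nonneg _) ?_
      exact (integral_smear_mul_le hρnonneg hρi hη0 (fun x => h01 _) _).trans_eq hρint
    · rw [Set.indicator_of_notMem hp, integral_smear_mul_eq_zero hρsupp hη0, mul_zero]
      intro x hx
      refine h0 _ fun hx' => hp ?_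
      exact Kcube_mono (by linarith)
        (mem_Kcube_of_norm_sub_le ((smul_mem_Kcube_iff hR0).1 hx') hx)
  · obtain ⟨ε, hεu, hε0⟩ := (((hcont 2).eventually (gt_mem_nhds hu)).and
      self_mem_nhdsWithin).exists
    obtain ⟨ψ, hψ, h01, h1, h0⟩ := exists_cutoff_Kcube d (show 1 + ε < 1 + 2 * ε by linarith)
    have hI := (hcutint ψ _ _ (by linarith) (by linarith) hψ h01 h1 h0).2
    have hlt : m * ((∫ x, ψ x) / 2 ^ d) < u := lt_of_le_of_lt (by gcongr) hεu
    filter_upwards [(hlimit ψ _ (by linarith) hψ h0).eventually (gt_mem_nhds hlt),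
      eventually_gt_atTop 0, eventually_ge_atTop ε⁻¹] with R hR hR0 hRε
    refine lt_of_le_of_lt ?_ hR
    rw [inv_le_iff_one_le_mul₀ hε0] at hRε
    gcongr ?_ / _
    refine (hsummable' R).tsum_le_tsum (fun p => ?_) (hsummable R _ hR0 ψ h0)
    by_cases hp : (p : Euc d) ∈ Kcube d R
    · rw [Set.indicator_of_mem hp, integral_smear_mul_eq_of_one hρsupp hη0, hρint, mul_one]
      intro x hx
      refine h1 _ ((smul_mem_Kcube_iff hR0).2 ?_)
      rw [norm_sub_rev] at hx
      exact Kcube_mono (by linarith) (mem_Kcube_of_norm_sub_le hp hx)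
    · rw [Set.indicator_of_notMem hp]
      exact mul_nonneg (Nat.cast_nonneg _)
        (integral_smear_mul_nonneg hρnonneg hη0 (fun x => (h01 _).1) _)
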